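/- DRAO linear rate for smooth strongly convex problems (Theorem 3.2): in the smooth setting, assume u is α-strongly convex with α > 0 and let κ := L_f/α. Run DRAO with constant stepsizes θ_t = θ := (√(4κ+1) − 1)/(√(4κ+1) + 1), w_t = (1/θ)^{t−1}, τ_t = τ := (√(4κ+1) − 1)/2, η_t = η := α(√(4κ+1) − 1)/2. Then the last iterate satisfies ‖x^N − x*‖² ≤ θ^N (1 + κ) ‖x⁰ − x*‖² for every N ≥ 1, where x* is the minimizer of f over X. -/

import Mathlib

open RealInnerProductSpace

lemma aux_small {A B s0 : ℝ} (hs0 : 0 < s0)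
    (h : ∀ s : ℝ, 0 < s → s ≤ s0 → A ≤ s * B) : A ≤ 0 := by
  by_contra hA
  push Not at hA
  have hB : 0 < |B| + 1 := by positivity
  have hpos : 0 < min s0 (A / (2 * (|B| + 1))) := lt_min hs0 (by positivity)
  have h1 := h (min s0 (A / (2 * (|B| + 1)))) hpos (min_le_left _ _)
  have h2 : min s0 (A / (2 * (|B| + 1))) * B ≤ min s0 (A / (2 * (|B| + 1))) * (|B| + 1) :=
    mul_le_mul_of_nonneg_left (by linarith [le_abs_self B]) hpos.le
  have h4 : min s0 (A / (2 * (|B| + 1))) * (|B| + 1) ≤ (A / (2 * (|B| + 1))) * (|B| + 1) :=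
    mul_le_mul_of_nonneg_right (min_le_right _ _) hB.le
  have h3 : (A / (2 * (|B| + 1))) * (|B| + 1) = A / 2 := by field_simp
  linarith

section
set_option linter.unusedSectionVars false
variable {E : Type*} [NormedAddCommGroup E] [InnerProductSpace ℝ E] [CompleteSpace E]

lemma aux_descent {h : E → ℝ} {g : E → E} {L : ℝ}
    (hg : ∀ x, HasGradientAt h (g x) x)
    (hL : ∀ x y, ‖g x - g y‖ ≤ L * ‖x - y‖) (x y : E) :
    h y ≤ h x + ⟪g x, y - x⟫ + L / 2 * ‖y - x‖ ^ 2 := by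
  have hline : ∀ s : ℝ, HasDerivAt (fun s : ℝ => x + s • (y - x)) (y - x) s := by
    intro s
    have := ((hasDerivAt_id s).smul_const (y - x)).const_add x
    simpa using this
  have hd : ∀ s : ℝ, HasDerivAt (fun s : ℝ => h (x + s • (y - x)))
      ⟪g (x + s • (y - x)), y - x⟫ s := by
    intro s
    have h1 := (hg (x + s • (y - x))).hasFDerivAt
    have := h1.comp_hasDerivAt s (hline s)
    simpa using! this
  have hB : ∀ s : ℝ, HasDerivAt
      (fun s : ℝ => h x + s * ⟪g x, y - x⟫ + L / 2 * s ^ 2 * ‖y - x‖ ^ 2)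
      (⟪g x, y - x⟫ + L * s * ‖y - x‖ ^ 2) s := by
    intro s
    have h1 := (((hasDerivAt_id s).mul_const ⟪g x, y - x⟫).const_add (h x)).add
      ((((hasDerivAt_id s).pow 2).const_mul (L / 2)).mul_const (‖y - x‖ ^ 2))
    convert! h1 using 1
    have e : (2 - 1 : ℕ) = 1 := rfl
    rw [e]
    push_cast
    simp only [id]
    ring
  have key := image_le_of_deriv_right_le_deriv_boundary (a := 0) (b := 1)
    (f := fun s : ℝ => h (x + s • (y - x)))
    (fun s _ => (hd s).continuousAt.continuousWithinAt)
    (fun s _ => (hd s).hasDerivWithinAt)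
    (B := fun s : ℝ => h x + s * ⟪g x, y - x⟫ + L / 2 * s ^ 2 * ‖y - x‖ ^ 2)
    (by simp)
    (fun s _ => (hB s).continuousAt.continuousWithinAt)
    (fun s _ => (hB s).hasDerivWithinAt)
    (by
      intro s hs
      have h1 : ⟪g (x + s • (y - x)) - g x, y - x⟫ ≤ L * s * ‖y - x‖ ^ 2 := by
        refine (real_inner_le_norm _ _).trans ?_
        have := hL (x + s • (y - x)) x
        rw [add_sub_cancel_left, norm_smul, Real.norm_of_nonneg hs.1] at this
        calc _ ≤ (L * (s * ‖y - x‖)) * ‖y - x‖ :=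
              mul_le_mul_of_nonneg_right this (norm_nonneg _)
          _ = _ := by ring
      rw [inner_sub_left] at h1
      linarith)
    (x := 1) (by simp)
  simpa using key

lemma aux_grad {h : E → ℝ} {g : E → E} {L : ℝ}
    (hcv : ConvexOn ℝ Set.univ h)
    (hg : ∀ x, HasGradientAt h (g x) x)
    (hL : ∀ x y, ‖g x - g y‖ ≤ L * ‖x - y‖) (x y : E) :
    h x + ⟪g x, y - x⟫ ≤ h y := by
  have := aux_small (A := h x + ⟪g x, y - x⟫ - h y) (B := L / 2 * ‖y - x‖ ^ 2) (s0 := 1)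
    one_pos (by
      intro s hs hs1
      have h1 := aux_descent (h := fun z => - h z) (g := fun z => - g z) (L := L)
        (fun z => by
          have := (hg z).hasFDerivAt.neg
          rw [hasGradientAt_iff_hasFDerivAt]
          simpa using! this)
        (fun a b => by
          have := hL a b
          rwa [← norm_neg, neg_sub_neg, norm_neg, ← norm_neg, neg_sub]) x (x + s • (y - x))
      have h2 := hcv.2 (Set.mem_univ x) (Set.mem_univ y) (sub_nonneg.2 hs1) hs.le (by ring)
      have e : (1 - s) • x + s • y = x + s • (y - x) := by module
      rw [e] at h2
      simp only [smul_eq_mul, add_sub_cancel_left, inner_neg_left, inner_smul_right,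
        norm_smul, Real.norm_of_nonneg hs.le] at h1 h2
      have h3 : s * (h x + ⟪g x, y - x⟫ - h y) ≤ s * (s * (L / 2 * ‖y - x‖ ^ 2)) := by
        nlinarith
      exact le_of_mul_le_mul_left h3 hs)
  linarith

lemma aux_coco {h : E → ℝ} {g : E → E} {L : ℝ} (hLpos : 0 < L)
    (hcv : ConvexOn ℝ Set.univ h)
    (hg : ∀ x, HasGradientAt h (g x) x)
    (hL : ∀ x y, ‖g x - g y‖ ≤ L * ‖x - y‖) (x y : E) :
    h x + ⟪g x, y - x⟫ + ‖g y - g x‖ ^ 2 / (2 * L) ≤ h y := by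
  have h1 := aux_grad hcv hg hL x (y - L⁻¹ • (g y - g x))
  have h2 := aux_descent hg hL y (y - L⁻¹ • (g y - g x))
  have e1 : y - L⁻¹ • (g y - g x) - x = (y - x) - L⁻¹ • (g y - g x) := by abel
  have e2 : y - L⁻¹ • (g y - g x) - y = - (L⁻¹ • (g y - g x)) := by abel
  rw [e1, inner_sub_right, inner_smul_right] at h1
  rw [e2, inner_neg_right, inner_smul_right, norm_neg, norm_smul,
    Real.norm_of_nonneg (inv_nonneg.2 hLpos.le)] at h2
  have h3 : ⟪g y, g y - g x⟫ - ⟪g x, g y - g x⟫ = ‖g y - g x‖ ^ 2 := by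
    rw [← inner_sub_left, real_inner_self_eq_norm_sq]
  have h4 : L⁻¹ * ⟪g y, g y - g x⟫ - L⁻¹ * ⟪g x, g y - g x⟫ = L⁻¹ * ‖g y - g x‖ ^ 2 := by
    rw [← h3]; ring
  have h5 : L / 2 * (L⁻¹ * ‖g y - g x‖) ^ 2 = ‖g y - g x‖ ^ 2 / (2 * L) := by
    field_simp
  have h6 : L⁻¹ * ‖g y - g x‖ ^ 2 = 2 * (‖g y - g x‖ ^ 2 / (2 * L)) := by
    field_simp
  linarith

/-- Strongly convex prox step. -/
lemma aux_prox {X : Set E} (hX : Convex ℝ X) {G u : E → ℝ} {α η : ℝ} {a b c : E}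
    (hG : ConvexOn ℝ Set.univ G) (hu : StrongConvexOn Set.univ α u)
    (ha : a ∈ X) (hb : b ∈ X)
    (hmin : IsMinOn (fun z => G z + u z + η / 2 * ‖z - c‖ ^ 2) X a) :
    G a + u a + η / 2 * ‖a - c‖ ^ 2 + (α + η) / 2 * ‖a - b‖ ^ 2
      ≤ G b + u b + η / 2 * ‖b - c‖ ^ 2 := by
  have := aux_small (A := G a + u a + η / 2 * ‖a - c‖ ^ 2 + (α + η) / 2 * ‖a - b‖ ^ 2
      - (G b + u b + η / 2 * ‖b - c‖ ^ 2)) (B := (α + η) / 2 * ‖a - b‖ ^ 2) (s0 := 1)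
    one_pos (by
      intro s hs hs1
      have hz := hX ha hb (sub_nonneg.2 hs1) hs.le (by ring)
      have h0 := hmin hz
      simp only [Set.mem_ofPred_eq] at h0
      have h1 := hG.2 (Set.mem_univ a) (Set.mem_univ b) (sub_nonneg.2 hs1) hs.le (by ring)
      have h2 := hu.2 (Set.mem_univ a) (Set.mem_univ b) (sub_nonneg.2 hs1) hs.le (by ring)
      simp only [smul_eq_mul] at h1 h2
      have h3 : ‖(1 - s) • a + s • b - c‖ ^ 2
          = (1 - s) * ‖a - c‖ ^ 2 + s * ‖b - c‖ ^ 2 - s * (1 - s) * ‖a - b‖ ^ 2 := by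
        have e1 : (1 - s) • a + s • b - c = (1 - s) • (a - c) + s • (b - c) := by module
        have e2 : a - b = (a - c) - (b - c) := by abel
        rw [e1, e2]
        generalize a - c = v
        generalize b - c = w
        rw [norm_add_sq_real, norm_sub_sq_real, norm_smul, norm_smul, inner_smul_left,
          inner_smul_right, Real.norm_of_nonneg hs.le, Real.norm_of_nonneg (sub_nonneg.2 hs1)]
        simp
        ring
      rw [h3] at h0
      refine le_of_mul_le_mul_left ?_ hs
      nlinarith)
  linarith

/-- First-order optimality. -/
lemma aux_fo {X : Set E} (hX : Convex ℝ X) {h u : E → ℝ} {g : E → E} {L : ℝ} {a b : E}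
    (hg : ∀ x, HasGradientAt h (g x) x)
    (hL : ∀ x y, ‖g x - g y‖ ≤ L * ‖x - y‖)
    (hu : ConvexOn ℝ Set.univ u) (ha : a ∈ X) (hb : b ∈ X)
    (hmin : ∀ z ∈ X ∩ Metric.closedBall a 1, h a + u a ≤ h z + u z) :
    0 ≤ ⟪g a, b - a⟫ + u b - u a := by
  have := aux_small (A := -(⟪g a, b - a⟫ + u b - u a)) (B := L / 2 * ‖b - a‖ ^ 2)
    (s0 := 1 / (1 + ‖b - a‖)) (by positivity) (by
      intro s hs hs1
      have hsn : s * (1 + ‖b - a‖) ≤ 1 := by rwa [le_div_iff₀ (by positivity)] at hs1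
      have hs2 : s ≤ 1 := by nlinarith [norm_nonneg (b - a)]
      have hz := hX ha hb (sub_nonneg.2 hs2) hs.le (by ring)
      have h1 := hu.2 (Set.mem_univ a) (Set.mem_univ b) (sub_nonneg.2 hs2) hs.le (by ring)
      have e : (1 - s) • a + s • b = a + s • (b - a) := by module
      rw [e] at hz h1
      have h2 := hmin _ ⟨hz, by
        rw [Metric.mem_closedBall, dist_eq_norm, add_sub_cancel_left, norm_smul,
          Real.norm_of_nonneg hs.le]
        linarith⟩
      have h3 := aux_descent hg hL a (a + s • (b - a))
      simp only [smul_eq_mul, add_sub_cancel_left, inner_smul_right,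
        norm_smul, Real.norm_of_nonneg hs.le] at h1 h3
      refine le_of_mul_le_mul_left ?_ hs
      nlinarith)
  linarith

/-- One-step contraction of the Lyapunov function. -/
lemma aux_step {α τ θ L η : ℝ} (hα : 0 < α) (hτ : 0 < τ) (hθ : θ * (1 + τ) = τ)
    (hL : L = α * τ * (1 + τ)) (hη : η = α * τ)
    {xs x1 x0 xm y1 y0 g1 g0 : E} {B1 B0 : ℝ}
    (hy : (1 + τ) • y1 = (x0 + θ • (x0 - xm)) + τ • y0)
    (hV : B1 + ⟪g1, y0 - y1⟫ + ‖g0 - g1‖ ^ 2 / (2 * L) ≤ B0)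
    (hA : B1 + ⟪g1, x1 - y1⟫ + η / 2 * ‖x1 - x0‖ ^ 2 + (α + η) / 2 * ‖x1 - xs‖ ^ 2
      ≤ η / 2 * ‖x0 - xs‖ ^ 2) :
    (1 + τ) * B1 + (α + η) / 2 * ‖x1 - xs‖ ^ 2 + ⟪g1, x1 - x0⟫ + η / 2 * ‖x1 - x0‖ ^ 2 ≤
    θ * ((1 + τ) * B0 + (α + η) / 2 * ‖x0 - xs‖ ^ 2 + ⟪g0, x0 - xm⟫
      + η / 2 * ‖x0 - xm‖ ^ 2) := by
  have hLpos : 0 < L := by rw [hL]; positivity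
  have e1 : x1 - y1 = (x1 - x0) - θ • (x0 - xm) - τ • (y0 - y1) := by
    have : y1 = (x0 + θ • (x0 - xm)) + τ • y0 - τ • y1 := by rw [← hy]; module
    nth_rewrite 1 [this]
    module
  rw [e1, inner_sub_right, inner_sub_right, inner_smul_right, inner_smul_right] at hA
  have hτV := mul_le_mul_of_nonneg_left hV hτ.le
  have hcs : θ * ⟪g1 - g0, x0 - xm⟫ ≤ τ * (‖g0 - g1‖ ^ 2 / (2 * L))
      + θ * (η / 2 * ‖x0 - xm‖ ^ 2) := by
    have hθe : θ = τ / (1 + τ) := by field_simp; linarith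
    have h1 := real_inner_le_norm (g1 - g0) (x0 - xm)
    rw [norm_sub_rev g1 g0] at h1
    have h2 : 0 ≤ (‖g0 - g1‖ - θ * L / τ * ‖x0 - xm‖) ^ 2 := sq_nonneg _
    have hθp : 0 ≤ θ := by rw [hθe]; positivity
    refine (mul_le_mul_of_nonneg_left h1 hθp).trans ?_
    generalize ‖g0 - g1‖ = p at *
    generalize ‖x0 - xm‖ = q at *
    rw [← sub_nonneg]
    have : τ * (p ^ 2 / (2 * L)) + θ * (η / 2 * q ^ 2) - θ * (p * q)
        = τ / (2 * L) * (p - θ * L / τ * q) ^ 2 := by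
      rw [hθe, hη, hL]; field_simp; ring
    rw [this]; positivity
  rw [inner_sub_left] at hcs
  have e2 : θ * ((1 + τ) * B0) = τ * B0 := by rw [← mul_assoc, hθ]
  have e3 : θ * ((α + η) / 2 * ‖x0 - xs‖ ^ 2) = η / 2 * ‖x0 - xs‖ ^ 2 := by
    have : θ * (α + η) = η := by rw [hη]; linear_combination α * hθ
    linear_combination (‖x0 - xs‖ ^ 2 / 2) * this
  rw [mul_add, mul_add, mul_add, e2, e3]
  linarith

lemma aux_lower {α τ L η : ℝ} (hα : 0 < α) (hτ : 0 < τ)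
    (hL : L = α * τ * (1 + τ)) (hη : η = α * τ)
    {d g : E} {B : ℝ} (hB : ‖g‖ ^ 2 / (2 * L) ≤ B) :
    0 ≤ (1 + τ) * B + ⟪g, d⟫ + η / 2 * ‖d‖ ^ 2 := by
  have h1 := mul_le_mul_of_nonneg_left hB (by positivity : 0 ≤ 1 + τ)
  have h2 := (abs_le.1 (abs_real_inner_le_norm g d)).1
  have h3 : (1 + τ) * (‖g‖ ^ 2 / (2 * L)) - ‖g‖ * ‖d‖ + η / 2 * ‖d‖ ^ 2
      = 1 / (2 * η) * (‖g‖ - η * ‖d‖) ^ 2 := by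
    rw [hL, hη]; field_simp; ring
  have h4 : 0 ≤ 1 / (2 * η) * (‖g‖ - η * ‖d‖) ^ 2 := by rw [hη]; positivity
  linarith

end

/-- **DRAO linear rate for smooth strongly convex problems** (Theorem 3.2):
with `κ = L_f/α`, `θ = (√(4κ+1) − 1)/(√(4κ+1) + 1)`, `w_t = (1/θ)^{t−1}`,
`τ = (√(4κ+1) − 1)/2`, `η = α(√(4κ+1) − 1)/2`, the last iterate satisfies
`‖x^N − x*‖² ≤ θ^N (1 + κ) ‖x⁰ − x*‖²` for all `N ≥ 1`. -/
theorem DRAO_smooth_strongly_convex_rate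
    (n m : ℕ) (hm : 1 ≤ m)
    (X : Set (EuclideanSpace ℝ (Fin n)))
    (hXne : X.Nonempty) (hXcl : IsClosed X) (hXcv : Convex ℝ X)
    (P : Set (Fin m → ℝ))
    (hPne : P.Nonempty) (hPcl : IsClosed P) (hPcv : Convex ℝ P)
    (hPsub : ∀ p ∈ P, (∑ i, p i) = 1 ∧ ∀ i, 0 ≤ p i)
    -- `u` is `α`-strongly convex with `α > 0`
    (α : ℝ) (hαpos : 0 < α)
    (u : EuclideanSpace ℝ (Fin n) → ℝ) (hu : StrongConvexOn Set.univ α u)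
    (ρstar : (Fin m → ℝ) → ℝ)
    (hρcv : ConvexOn ℝ Set.univ ρstar) (hρlsc : LowerSemicontinuous ρstar)
    -- smooth setting
    (fi : Fin m → EuclideanSpace ℝ (Fin n) → ℝ)
    (hficv : ∀ i, ConvexOn ℝ Set.univ (fi i))
    (hfidiff : ∀ i, Differentiable ℝ (fi i))
    (Li : Fin m → ℝ)
    (hLi : ∀ i, ∀ x y : EuclideanSpace ℝ (Fin n),
      ‖gradient (fi i) x - gradient (fi i) y‖ ≤ Li i * ‖x - y‖)
    (Lf : ℝ) (hLfpos : 0 < Lf)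
    (hLf : ∀ p ∈ P, ∀ x y : EuclideanSpace ℝ (Fin n),
      ‖∑ i, p i • (gradient (fi i) x - gradient (fi i) y)‖ ≤ Lf * ‖x - y‖)
    -- the objective `f` and its minimizer `x*` over `X`
    (f : EuclideanSpace ℝ (Fin n) → ℝ)
    (hf : ∀ xx, IsLUB ((fun p => (∑ i, p i * fi i xx) - ρstar p) '' P) (f xx - u xx))
    (xstar : EuclideanSpace ℝ (Fin n)) (hxstarX : xstar ∈ X) (hxstar : IsMinOn f X xstar)
    -- condition number and constant stepsizes
    (κ θ τ η : ℝ)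
    (hκ : κ = Lf / α)
    (hθ : θ = (Real.sqrt (4 * κ + 1) - 1) / (Real.sqrt (4 * κ + 1) + 1))
    (hτ : τ = (Real.sqrt (4 * κ + 1) - 1) / 2)
    (hη : η = α * (Real.sqrt (4 * κ + 1) - 1) / 2)
    -- DRAO iterates (convention `x⁻¹ = x⁰` via `ℕ`-subtraction)
    (x : ℕ → EuclideanSpace ℝ (Fin n)) (hx0 : x 0 ∈ X)
    (xund : ℕ → EuclideanSpace ℝ (Fin n)) (hxund0 : xund 0 = x 0)
    (hxund : ∀ t : ℕ, 1 ≤ t →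
      xund t = (1 + τ)⁻¹ •
        ((x (t-1) + θ • (x (t-1) - x (t-2))) + τ • xund (t-1)))
    (hxupd : ∀ t : ℕ, 1 ≤ t → x t ∈ X ∧
      IsMinOn (fun xx =>
        sSup ((fun p =>
          (∑ i, p i * (fi i (xund t) + ⟪gradient (fi i) (xund t), xx - xund t⟫))
            - ρstar p) '' P)
        + u xx + η / 2 * ‖xx - x (t-1)‖ ^ 2) X (x t)) :
    ∀ N : ℕ, 1 ≤ N →
      ‖x N - xstar‖ ^ 2 ≤ θ ^ N * (1 + κ) * ‖x 0 - xstar‖ ^ 2 := by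
  -- parameters
  have hκpos : 0 < κ := by rw [hκ]; positivity
  have hsq : Real.sqrt (4 * κ + 1) ^ 2 = 4 * κ + 1 := Real.sq_sqrt (by positivity)
  have hs1 : 1 < Real.sqrt (4 * κ + 1) := by
    rw [Real.lt_sqrt (by norm_num)]; linarith
  have hτpos : 0 < τ := by rw [hτ]; linarith
  have hθτ : θ * (1 + τ) = τ := by
    rw [hθ, hτ]
    have : Real.sqrt (4 * κ + 1) + 1 ≠ 0 := by linarith
    field_simp
    ring
  have hητ : η = α * τ := by rw [hη, hτ]; ring
  have hκτ : κ = τ * (1 + τ) := by rw [hτ]; linear_combination (-1 / 4) * hsq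
  have hLκ : Lf = α * κ := by rw [hκ]; field_simp
  have hLτ : Lf = α * τ * (1 + τ) := by rw [hLκ, hκτ]; ring
  have hθpos : 0 ≤ θ := by
    rw [hθ]; apply div_nonneg <;> linarith
  have hηpos : 0 < η := by rw [hητ]; positivity
  -- gradients
  have hfig : ∀ i z, HasGradientAt (fi i) (gradient (fi i) z) z :=
    fun i z => (hfidiff i z).hasGradientAt
  have hlin : ∀ i a b, fi i a + ⟪gradient (fi i) a, b - a⟫ ≤ fi i b :=
    fun i a b => aux_grad (hficv i) (hfig i) (hLi i) a b
  have hucv : ConvexOn ℝ Set.univ u := (hu.strictConvexOn hαpos).convexOn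
  have hucont : Continuous u := by
    rw [← continuousOn_univ]; exact hucv.continuousOn isOpen_univ
  have hρcont : Continuous ρstar := by
    rw [← continuousOn_univ]; exact hρcv.continuousOn isOpen_univ
  have hhcv : ∀ p ∈ P, ConvexOn ℝ Set.univ (fun z => ∑ i, p i * fi i z) := by
    intro p hp
    refine ⟨convex_univ, ?_⟩
    intro a _ b _ s t hs ht hst
    simp only [smul_eq_mul, Finset.mul_sum, ← Finset.sum_add_distrib]
    refine Finset.sum_le_sum fun i _ => ?_
    have := mul_le_mul_of_nonneg_left
      ((hficv i).2 (Set.mem_univ a) (Set.mem_univ b) hs ht hst) ((hPsub p hp).2 i)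
    simp only [smul_eq_mul] at this
    linarith
  have hhg : ∀ p : Fin m → ℝ, ∀ z, HasGradientAt (fun z => ∑ i, p i * fi i z)
      (∑ i, p i • gradient (fi i) z) z := by
    intro p z
    rw [hasGradientAt_iff_hasFDerivAt]
    have := HasFDerivAt.fun_sum (u := Finset.univ)
      (fun i _ => ((hfig i z).hasFDerivAt.const_mul (p i)))
    simpa using! this
  have hPcpt : IsCompact P :=
    (isCompact_stdSimplex ℝ (Fin m)).of_isClosed_subset hPcl
      (fun p hp => ⟨(hPsub p hp).2, (hPsub p hp).1⟩)
  -- saddle point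
  obtain ⟨a, ha, p, hp, hsad⟩ := Sion.exists_isSaddlePointOn
    (X := X ∩ Metric.closedBall xstar 1) (Y := P)
    (f := fun z q => (∑ i, q i * fi i z) - ρstar q + u z)
    ⟨xstar, hxstarX, by simp⟩ (hXcv.inter (convex_closedBall _ _))
    ((isCompact_closedBall xstar 1).inter_left hXcl)
    (fun q hq => by
      refine LowerSemicontinuous.lowerSemicontinuousOn (Continuous.lowerSemicontinuous ?_) _
      have : ∀ i, Continuous (fi i) := fun i => (hfidiff i).continuous
      fun_prop)
    (fun q hq => by
      have h1 : ConvexOn ℝ Set.univ (fun z => (∑ i, q i * fi i z) - ρstar q + u z) := by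
        simpa only [sub_eq_add_neg] using! ((hhcv q hq).add_const (-ρstar q)).add hucv
      exact (h1.subset (Set.subset_univ _)
        (hXcv.inter (convex_closedBall _ _))).quasiconvexOn)
    hPcv hPne hPcpt
    (fun z hz => by
      refine UpperSemicontinuous.upperSemicontinuousOn (Continuous.upperSemicontinuous ?_) _
      fun_prop)
    (fun z hz => by
      refine ConcaveOn.quasiconcaveOn ⟨hPcv, ?_⟩
      intro q _ r _ s t hs ht hst
      have h1 := hρcv.2 (Set.mem_univ q) (Set.mem_univ r) hs ht hst
      simp only [smul_eq_mul, Pi.add_apply, Pi.smul_apply] at h1 ⊢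
      have h2 : ∑ i, (s * q i + t * r i) * fi i z
          = s * ∑ i, q i * fi i z + t * ∑ i, r i * fi i z := by
        simp only [Finset.mul_sum, ← Finset.sum_add_distrib]
        exact Finset.sum_congr rfl fun i _ => by ring
      rw [h2]
      have h3 : s * u z + t * u z = u z := by rw [← add_mul, hst, one_mul]
      linarith)
  have hfle : ∀ z, ∀ q ∈ P, (∑ i, q i * fi i z) - ρstar q ≤ f z - u z :=
    fun z q hq => (hf z).1 ⟨q, hq, rfl⟩
  have hsad2 : ∀ z ∈ X ∩ Metric.closedBall xstar 1,
      f xstar ≤ (∑ i, p i * fi i z) - ρstar p + u z := by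
    intro z hz
    have h1 : f xstar ≤ f a := hxstar ha.1
    have h2 : f a - u a ≤ (∑ i, p i * fi i z) - ρstar p + u z - u a := by
      refine (hf a).2 ?_
      rintro _ ⟨q, hq, rfl⟩
      have := hsad z hz q hq
      simp only at this ⊢
      linarith
    linarith
  -- the fixed smooth function
  set h : EuclideanSpace ℝ (Fin n) → ℝ := fun z => ∑ i, p i * fi i z with hh
  set g : EuclideanSpace ℝ (Fin n) → EuclideanSpace ℝ (Fin n) :=
    fun z => ∑ i, p i • gradient (fi i) z with hgdef
  have hg : ∀ z, HasGradientAt h (g z) z := hhg p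
  have hcv : ConvexOn ℝ Set.univ h := hhcv p hp
  have hgL : ∀ a b, ‖g a - g b‖ ≤ Lf * ‖a - b‖ := by
    intro a b
    have := hLf p hp a b
    simpa only [hgdef, smul_sub, Finset.sum_sub_distrib] using this
  have hval : f xstar = h xstar - ρstar p + u xstar := by
    have h1 := hsad2 xstar ⟨hxstarX, by simp⟩
    have h2 := hfle xstar p hp
    simp only [hh]
    linarith
  have hfo : ∀ b ∈ X, 0 ≤ ⟪g xstar, b - xstar⟫ + u b - u xstar := by
    intro b hb
    refine aux_fo hXcv hg hgL hucv hxstarX hb ?_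
    intro z hz
    have := hsad2 z hz
    rw [hval] at this
    simp only [hh] at this ⊢
    linarith
  -- Bregman distances
  set B : ℕ → ℝ := fun t => h (xund t) - h xstar - ⟪g xstar, xund t - xstar⟫ with hB
  set G : ℕ → EuclideanSpace ℝ (Fin n) := fun t => g (xund t) - g xstar with hG
  have hBlow : ∀ t, ‖G t‖ ^ 2 / (2 * Lf) ≤ B t := by
    intro t
    have := aux_coco hLfpos hcv hg hgL xstar (xund t)
    simp only [hB, hG]
    linarith
  -- prox step
  have hA : ∀ t, B (t + 1) + ⟪G (t + 1), x (t + 1) - xund (t + 1)⟫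
      + η / 2 * ‖x (t + 1) - x t‖ ^ 2 + (α + η) / 2 * ‖x (t + 1) - xstar‖ ^ 2
      ≤ η / 2 * ‖x t - xstar‖ ^ 2 := by
    intro t
    obtain ⟨hxX, hmin⟩ := hxupd (t + 1) (by omega)
    rw [Nat.add_sub_cancel] at hmin
    set y := xund (t + 1) with hy
    set ℓ : EuclideanSpace ℝ (Fin n) → (Fin m → ℝ) → ℝ := fun z q =>
      (∑ i, q i * (fi i y + ⟪gradient (fi i) y, z - y⟫)) - ρstar q with hℓ
    have hℓle : ∀ z, ∀ q ∈ P, ℓ z q ≤ f z - u z := by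
      intro z q hq
      refine le_trans ?_ (hfle z q hq)
      simp only [hℓ]
      refine sub_le_sub_right (Finset.sum_le_sum fun i _ => ?_) _
      exact mul_le_mul_of_nonneg_left (hlin i y z) ((hPsub q hq).2 i)
    have hbdd : ∀ z, BddAbove (ℓ z '' P) := by
      intro z
      refine ⟨f z - u z, ?_⟩
      rintro _ ⟨q, hq, rfl⟩
      exact hℓle z q hq
    have hSle : ∀ z, ∀ q ∈ P, ℓ z q ≤ sSup (ℓ z '' P) :=
      fun z q hq => le_csSup (hbdd z) ⟨q, hq, rfl⟩
    have hScv : ConvexOn ℝ Set.univ (fun z => sSup (ℓ z '' P)) := by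
      refine ⟨convex_univ, ?_⟩
      intro z _ w _ s r hs hr hsr
      refine csSup_le (hPne.image _) ?_
      rintro _ ⟨q, hq, rfl⟩
      have h1 := mul_le_mul_of_nonneg_left (hSle z q hq) hs
      have h2 := mul_le_mul_of_nonneg_left (hSle w q hq) hr
      have h3 : ℓ (s • z + r • w) q = s * ℓ z q + r * ℓ w q := by
        have hr' : r = 1 - s := by linarith
        have e : ∀ i, q i * (fi i y + ⟪gradient (fi i) y, s • z + r • w - y⟫)
            = s * (q i * (fi i y + ⟪gradient (fi i) y, z - y⟫))
              + r * (q i * (fi i y + ⟪gradient (fi i) y, w - y⟫)) := by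
          intro i
          simp only [inner_sub_right, inner_add_right, inner_smul_right]
          rw [hr']; ring
        simp only [hℓ, e, Finset.sum_add_distrib, ← Finset.mul_sum]
        rw [hr']; ring
      simp only [smul_eq_mul]
      linarith
    have hprox := aux_prox (G := fun z => sSup (ℓ z '' P)) (u := u) (α := α) (η := η)
      (c := x t) hXcv hScv hu hxX hxstarX hmin
    have h1 : ℓ (x (t + 1)) p ≤ sSup (ℓ (x (t + 1)) '' P) := hSle _ p hp
    have h2 : sSup (ℓ xstar '' P) ≤ f xstar - u xstar := by
      refine csSup_le (hPne.image _) ?_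
      rintro _ ⟨q, hq, rfl⟩
      exact hℓle xstar q hq
    have h3 : ℓ (x (t + 1)) p = h y + ⟪g y, x (t + 1) - y⟫ - ρstar p := by
      simp only [hℓ, hh, hgdef, sum_inner, real_inner_smul_left, mul_add, Finset.sum_add_distrib]
    have h4 := hfo (x (t + 1)) hxX
    rw [norm_sub_rev xstar (x t)] at hprox
    have h5 : ⟪g xstar, x (t + 1) - xstar⟫
        = ⟪g xstar, x (t + 1) - y⟫ + ⟪g xstar, y - xstar⟫ := by
      rw [← inner_add_right]; congr 1; abel
    have h6 : B (t + 1) = h y - h xstar - ⟪g xstar, y - xstar⟫ := rfl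
    have h7 : ⟪G (t + 1), x (t + 1) - y⟫ = ⟪g y, x (t + 1) - y⟫ - ⟪g xstar, x (t + 1) - y⟫ := by
      rw [← inner_sub_left]
    linarith
  -- Lyapunov function
  have hmain : ∀ N, (1 + τ) * B N + (α + η) / 2 * ‖x N - xstar‖ ^ 2 + ⟪G N, x N - x (N - 1)⟫
      + η / 2 * ‖x N - x (N - 1)‖ ^ 2
      ≤ θ ^ N * ((1 + τ) * B 0 + (α + η) / 2 * ‖x 0 - xstar‖ ^ 2) := by
    intro N
    induction N with
    | zero => simp
    | succ t ih =>
      have hy : (1 + τ) • xund (t + 1) = (x t + θ • (x t - x (t - 1))) + τ • xund t := by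
        have h1 := hxund (t + 1) (by omega)
        have e : t + 1 - 2 = t - 1 := by omega
        rw [Nat.add_sub_cancel, e] at h1
        rw [h1, smul_smul, mul_inv_cancel₀ (by positivity), one_smul]
      have hV : B (t + 1) + ⟪G (t + 1), xund t - xund (t + 1)⟫
          + ‖G t - G (t + 1)‖ ^ 2 / (2 * Lf) ≤ B t := by
        have h1 := aux_coco hLfpos hcv hg hgL (xund (t + 1)) (xund t)
        have e : G t - G (t + 1) = g (xund t) - g (xund (t + 1)) := by
          simp only [hG]; abel
        rw [e]
        have h2 : ⟪g xstar, xund t - xstar⟫ = ⟪g xstar, xund t - xund (t + 1)⟫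
            + ⟪g xstar, xund (t + 1) - xstar⟫ := by
          rw [← inner_add_right]; congr 1; abel
        simp only [hB, hG, inner_sub_left (g (xund (t + 1))) (g xstar)]
        linarith
      have hstep := aux_step hαpos hτpos hθτ hLτ hητ (xs := xstar) hy hV (hA t)
      rw [Nat.add_sub_cancel]
      refine hstep.trans ?_
      rw [pow_succ' θ t, mul_assoc]
      exact mul_le_mul_of_nonneg_left ih hθpos
  intro N _
  have h1 := hmain N
  have h2 := aux_lower hαpos hτpos hLτ hητ (d := x N - x (N - 1)) (hBlow N)
  have h3 : B 0 ≤ Lf / 2 * ‖x 0 - xstar‖ ^ 2 := by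
    have := aux_descent hg hgL xstar (xund 0)
    simp only [hB]
    rw [hxund0] at this ⊢
    linarith
  have h4 : (1 + τ) * B 0 + (α + η) / 2 * ‖x 0 - xstar‖ ^ 2
      ≤ (α + η) / 2 * ((1 + κ) * ‖x 0 - xstar‖ ^ 2) := by
    have h5 := mul_le_mul_of_nonneg_left h3 (by positivity : 0 ≤ 1 + τ)
    rw [hLκ] at h5
    rw [hητ]
    linarith
  have h5 := mul_le_mul_of_nonneg_left h4 (pow_nonneg hθpos N)
  have h6 : (α + η) / 2 * ‖x N - xstar‖ ^ 2
      ≤ (α + η) / 2 * (θ ^ N * (1 + κ) * ‖x 0 - xstar‖ ^ 2) := by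
    linarith
  exact le_of_mul_le_mul_left h6 (by positivity)
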